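/- Generalized Jacobi–Trudi formula for the deformed Schur polynomials C_λ (equality of (6.4) and (6.6)). Let N ≥ 1, q, γ, s_0 ∈ ℂ, ξ_0 ∈ ℂ∖{0}, let u_1,…,u_N be pairwise distinct complex numbers, and let λ ∈ Sign_N. Then det[c_{λ_i+N−i}(u_j)]_{i,j=1}^N / ∏_{1≤i<j≤N}(u_i−u_j) = det_{1≤i,j≤N}[ −γs_0ξ_0^{−1}(1−q^{λ_j+N−j}) h_{λ_j+i−j−1} + (1+γ²s_0²−γ(q+s_0²)q^{λ_j+N−j}) h_{λ_j+i−j} − γs_0ξ_0(1−q^{λ_j+N−j+1}) h_{λ_j+i−j+1} ], where h_k = h_k(u_1,…,u_N) is the complete homogeneous symmetric polynomial of degree k (with h_0 = 1 and h_k = 0 for k < 0). -/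

import Mathlib

open scoped BigOperators

noncomputable section

/-- The Vandermonde-type product `∏_{1 ≤ i < j ≤ N} (w i − w j)`. -/
def vandP {N : ℕ} (w : Fin N → ℂ) : ℂ :=
  ∏ p ∈ Finset.univ.filter (fun p : Fin N × Fin N => p.1 < p.2), (w p.1 - w p.2)

/-- `c_k(u) = u^k(1−γq^{k+1}+s₀²γ(γ−q^k)) − s₀γ((1−q^k)u^{k−1}/ξ₀ + (1−q^{k+1})u^{k+1}ξ₀)`
(the `u^{k−1}` term vanishes at `k = 0` since `1 − q^0 = 0`). -/
def cfun (q γ s0 ξ0 : ℂ) (k : ℕ) (u : ℂ) : ℂ :=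
  u ^ k * (1 - γ * q ^ (k + 1) + s0 ^ 2 * γ * (γ - q ^ k))
    - s0 * γ * ((1 - q ^ k) * u ^ (k - 1) / ξ0 + (1 - q ^ (k + 1)) * u ^ (k + 1) * ξ0)

/-- The complete homogeneous symmetric polynomial
`h_k(u_1,…,u_N) = Σ_{1≤i_1≤…≤i_k≤N} u_{i_1}⋯u_{i_k}`. -/
def hpoly {N : ℕ} (u : Fin N → ℂ) (k : ℕ) : ℂ :=
  ∑ m : Sym (Fin N) k, ((m : Multiset (Fin N)).map u).prod

/-- `h_k` for integer index, with `h_k = 0` for `k < 0`. -/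
def hZ {N : ℕ} (u : Fin N → ℂ) (k : ℤ) : ℂ :=
  if 0 ≤ k then hpoly u k.toNat else 0

lemma one_sub_mul_mk_pow (a : ℂ) :
    (1 - PowerSeries.C a * PowerSeries.X) * PowerSeries.mk (fun n => a ^ n) = 1 := by
  ext n
  rw [mul_comm, mul_sub, mul_one, mul_left_comm]
  cases n with
  | zero => simp
  | succ n => simp [PowerSeries.coeff_succ_mul_X, PowerSeries.coeff_one, pow_succ']

/-- The generating function of the complete homogeneous symmetric polynomials is a product of
geometric series. -/
lemma mk_hpoly {N : ℕ} (u : Fin N → ℂ) :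
    PowerSeries.mk (hpoly u) = ∏ i, PowerSeries.mk (fun n => u i ^ n) := by
  ext k
  rw [PowerSeries.coeff_mk, PowerSeries.coeff_prod, hpoly]
  refine Finset.sum_bij (fun m _ => Multiset.toFinsupp (m : Multiset (Fin N))) ?_ ?_ ?_ ?_
  · intro m _
    rw [Finset.mem_finsuppAntidiag']
    refine ⟨?_, Finset.subset_univ _⟩
    have h := Multiset.toFinsupp_sum_eq (m : Multiset (Fin N))
    rw [Sym.card_coe] at h
    exact h
  · intro m _ m' _ h
    exact Sym.coe_injective (Multiset.toFinsupp.injective h)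
  · intro f hf
    rw [Finset.mem_finsuppAntidiag'] at hf
    exact ⟨⟨Finsupp.toMultiset f, (Finsupp.card_toMultiset f).trans hf.1⟩, Finset.mem_univ _,
      Finsupp.toMultiset_toFinsupp f⟩
  · intro m _
    rw [Finset.prod_multiset_map_count]
    simp only [PowerSeries.coeff_mk, Multiset.toFinsupp_apply]
    refine Finset.prod_subset (Finset.subset_univ _) fun i _ hi => ?_
    rw [Multiset.count_eq_zero_of_notMem (by simpa using hi), pow_zero]

/-- `∏_{l ≠ j} (1 - u_l X)`, whose coefficients are the signed elementary symmetric polynomials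
in the variables other than `u_j`. -/
def eraseProd {N : ℕ} (u : Fin N → ℂ) (j : Fin N) : Polynomial ℂ :=
  ∏ l ∈ Finset.univ.erase j, (1 - Polynomial.C (u l) * Polynomial.X)

lemma eraseProd_coeff_eq_zero {N : ℕ} (u : Fin N → ℂ) (j : Fin N) {r : ℕ} (hr : N ≤ r) :
    (eraseProd u j).coeff r = 0 := by
  refine Polynomial.coeff_eq_zero_of_natDegree_lt (lt_of_lt_of_le ?_ hr)
  have h : (eraseProd u j).natDegree ≤ ∑ l ∈ Finset.univ.erase j, 1 := by
    refine (Polynomial.natDegree_prod_le _ _).trans (Finset.sum_le_sum fun l _ => ?_)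
    compute_degree
  have := j.pos
  simp only [Finset.sum_const, Finset.card_erase_of_mem (Finset.mem_univ j), Finset.card_univ,
    Fintype.card_fin, smul_eq_mul, mul_one] at h
  omega

lemma eraseProd_mul_mk_hpoly {N : ℕ} (u : Fin N → ℂ) (j : Fin N) :
    (eraseProd u j : PowerSeries ℂ) * PowerSeries.mk (hpoly u)
      = PowerSeries.mk fun n => u j ^ n := by
  have h : (eraseProd u j : PowerSeries ℂ)
      = ∏ l ∈ Finset.univ.erase j, (1 - PowerSeries.C (u l) * PowerSeries.X) := by
    rw [← Polynomial.coeToPowerSeries.ringHom_apply, eraseProd, map_prod]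
    simp [Polynomial.coe_sub]
  rw [h, mk_hpoly, ← Finset.mul_prod_erase _ _ (Finset.mem_univ j), mul_left_comm,
    ← Finset.prod_mul_distrib]
  simp only [one_sub_mul_mk_pow, Finset.prod_const_one, mul_one]

lemma hZ_natCast {N : ℕ} (u : Fin N → ℂ) (k : ℕ) : hZ u k = hpoly u k := by
  simp [hZ]

lemma hZ_of_neg {N : ℕ} (u : Fin N → ℂ) {k : ℤ} (hk : k < 0) : hZ u k = 0 :=
  if_neg hk.not_ge

lemma hZ_zero {N : ℕ} (u : Fin N → ℂ) : hZ u 0 = 1 := by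
  have h := hZ_natCast u 0
  rw [Nat.cast_zero] at h
  rw [h, ← PowerSeries.coeff_mk 0 (hpoly u), mk_hpoly]
  simp

lemma pow_eq_sum_hZ {N : ℕ} (u : Fin N → ℂ) (j : Fin N) (m : ℕ) :
    u j ^ m = ∑ i : Fin N,
      hZ u ((m : ℤ) + (i : ℕ) - (N - 1)) * (eraseProd u j).coeff (N - 1 - (i : ℕ)) := by
  have key := congrArg (PowerSeries.coeff m) (eraseProd_mul_mk_hpoly u j)
  rw [PowerSeries.coeff_mul, PowerSeries.coeff_mk,
    Finset.Nat.sum_antidiagonal_eq_sum_range_succ_mk] at key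
  simp only [Polynomial.coeff_coe, PowerSeries.coeff_mk] at key
  have hl : ∑ r ∈ Finset.range (m + 1), (eraseProd u j).coeff r * hpoly u (m - r)
      = ∑ r ∈ Finset.range (m + 1 + N), (eraseProd u j).coeff r * hZ u ((m : ℤ) - r) := by
    rw [← Finset.sum_subset (Finset.range_mono (Nat.le_add_right (m + 1) N))]
    · refine Finset.sum_congr rfl fun r hr => ?_
      rw [Finset.mem_range] at hr
      rw [← Nat.cast_sub (by omega), hZ_natCast]
    · intro r _ hr
      rw [Finset.mem_range] at hr
      rw [hZ_of_neg u (by omega), mul_zero]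
  have hr : ∑ r ∈ Finset.range N, (eraseProd u j).coeff r * hZ u ((m : ℤ) - r)
      = ∑ r ∈ Finset.range (m + 1 + N), (eraseProd u j).coeff r * hZ u ((m : ℤ) - r) := by
    refine Finset.sum_subset (Finset.range_mono (Nat.le_add_left N (m + 1))) fun r _ hr => ?_
    rw [Finset.mem_range] at hr
    rw [eraseProd_coeff_eq_zero u j (by omega), zero_mul]
  rw [← key, hl, ← hr, ← Finset.sum_range_reflect, Finset.sum_range]
  refine Finset.sum_congr rfl fun i _ => ?_
  rw [mul_comm]
  congr 2
  have := i.isLt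
  omega

lemma det_pow_eq_vandP {N : ℕ} (u : Fin N → ℂ) :
    Matrix.det (Matrix.of fun i j : Fin N => u j ^ (N - 1 - (i : ℕ))) = vandP u := by
  have h : (Matrix.of fun i j : Fin N => u j ^ (N - 1 - (i : ℕ)))
      = (Matrix.projVandermonde 1 u).transpose := by
    ext i j
    simp only [Matrix.of_apply, Matrix.transpose_apply, Matrix.projVandermonde_apply,
      Pi.one_apply, one_pow, one_mul, Fin.val_rev]
    congr 1
    omega
  rw [h, Matrix.det_transpose, Matrix.det_projVandermonde, vandP, Finset.prod_sigma']
  refine Finset.prod_bij (fun p _ => (p.1, p.2)) ?_ ?_ ?_ ?_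
  · simp
  · rintro ⟨a, b⟩ _ ⟨c, d⟩ _ h
    simpa using h
  · rintro ⟨a, b⟩ h
    exact ⟨⟨a, b⟩, by simpa using h, rfl⟩
  · simp

/-- The coefficients of `eraseProd`, in decreasing degree, form a matrix of determinant
`vandP u`. -/
lemma det_eraseProd_coeff {N : ℕ} (u : Fin N → ℂ) :
    Matrix.det (Matrix.of fun i j : Fin N => (eraseProd u j).coeff (N - 1 - (i : ℕ)))
      = vandP u := by
  have hmul : (Matrix.of fun i j : Fin N => u j ^ (N - 1 - (i : ℕ)))
      = (Matrix.of fun i j : Fin N => hZ u ((j : ℤ) - (i : ℕ)))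
        * Matrix.of fun i j : Fin N => (eraseProd u j).coeff (N - 1 - (i : ℕ)) := by
    ext i j
    rw [Matrix.mul_apply, Matrix.of_apply, pow_eq_sum_hZ u j]
    refine Finset.sum_congr rfl fun l _ => ?_
    simp only [Matrix.of_apply]
    congr 2
    omega
  have htri : Matrix.det (Matrix.of fun i j : Fin N => hZ u ((j : ℤ) - (i : ℕ))) = 1 := by
    rw [Matrix.det_of_isUpperTriangular]
    · simp [hZ_zero]
    · intro i j hij
      have hlt : j < i := hij
      exact hZ_of_neg u (by omega)
  rw [← det_pow_eq_vandP, hmul, Matrix.det_mul, htri, one_mul]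

lemma vandP_ne_zero {N : ℕ} {u : Fin N → ℂ} (hu : Function.Injective u) : vandP u ≠ 0 := by
  refine Finset.prod_ne_zero_iff.mpr fun p hp => sub_ne_zero.mpr fun h => ?_
  exact (Finset.mem_filter.mp hp).2.ne (hu h)

lemma cfun_eq_sum_hZ {N : ℕ} (q γ s0 ξ0 : ℂ) (u : Fin N → ℂ) (j : Fin N) (k : ℕ) :
    cfun q γ s0 ξ0 k (u j) = ∑ i : Fin N,
      (-(γ * s0 * ξ0⁻¹) * (1 - q ^ k) * hZ u ((k : ℤ) + (i : ℕ) - (N - 1) - 1)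
        + (1 + γ ^ 2 * s0 ^ 2 - γ * (q + s0 ^ 2) * q ^ k) * hZ u ((k : ℤ) + (i : ℕ) - (N - 1))
        - γ * s0 * ξ0 * (1 - q ^ (k + 1)) * hZ u ((k : ℤ) + (i : ℕ) - (N - 1) + 1))
      * (eraseProd u j).coeff (N - 1 - (i : ℕ)) := by
  have hlow : (1 - q ^ k) * u j ^ (k - 1) = (1 - q ^ k) * ∑ i : Fin N,
      hZ u ((k : ℤ) + (i : ℕ) - (N - 1) - 1) * (eraseProd u j).coeff (N - 1 - (i : ℕ)) := by
    cases k with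
    | zero => simp
    | succ k =>
      rw [Nat.add_sub_cancel, pow_eq_sum_hZ u j k]
      congr 1
      refine Finset.sum_congr rfl fun i _ => ?_
      congr 2
      push_cast
      ring
  have hhigh : u j ^ (k + 1) = ∑ i : Fin N,
      hZ u ((k : ℤ) + (i : ℕ) - (N - 1) + 1) * (eraseProd u j).coeff (N - 1 - (i : ℕ)) := by
    rw [pow_eq_sum_hZ u j (k + 1)]
    refine Finset.sum_congr rfl fun i _ => ?_
    congr 2
    push_cast
    ring
  rw [cfun, hlow, hhigh, pow_eq_sum_hZ u j k]
  simp only [sub_mul, add_mul, mul_assoc, Finset.sum_add_distrib, Finset.sum_sub_distrib,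
    ← Finset.mul_sum]
  ring

/-- Generalized Jacobi–Trudi formula for the deformed Schur polynomials `C_λ`
(equality of (6.4) and (6.6)). -/
theorem generalized_jacobi_trudi
    (N : ℕ) (hN : 1 ≤ N) (q γ s0 ξ0 : ℂ) (hξ : ξ0 ≠ 0)
    (u : Fin N → ℂ) (hu : Function.Injective u)
    (lam : Fin N → ℕ) (hlam : ∀ i j : Fin N, i ≤ j → lam j ≤ lam i) :
    Matrix.det (Matrix.of fun i j : Fin N =>
        cfun q γ s0 ξ0 (lam i + (N - 1 - (i : ℕ))) (u j)) / vandP u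
    = Matrix.det (Matrix.of fun i j : Fin N =>
        -(γ * s0 * ξ0⁻¹) * (1 - q ^ (lam j + (N - 1 - (j : ℕ))))
            * hZ u ((lam j : ℤ) + (i : ℕ) - (j : ℕ) - 1)
          + (1 + γ ^ 2 * s0 ^ 2 - γ * (q + s0 ^ 2) * q ^ (lam j + (N - 1 - (j : ℕ))))
            * hZ u ((lam j : ℤ) + (i : ℕ) - (j : ℕ))
          - γ * s0 * ξ0 * (1 - q ^ (lam j + (N - 1 - (j : ℕ)) + 1))
            * hZ u ((lam j : ℤ) + (i : ℕ) - (j : ℕ) + 1)) := by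
  rw [div_eq_iff (vandP_ne_zero hu), ← det_eraseProd_coeff u,
    ← Matrix.det_transpose (Matrix.of fun i j : Fin N => _ - _), ← Matrix.det_mul]
  congr 1
  ext i j
  rw [Matrix.of_apply, cfun_eq_sum_hZ, Matrix.mul_apply]
  refine Finset.sum_congr rfl fun l _ => ?_
  have hk : ((lam i + (N - 1 - (i : ℕ)) : ℕ) : ℤ) + (l : ℕ) - (N - 1)
      = (lam i : ℤ) + (l : ℕ) - (i : ℕ) := by omega
  rw [hk]
  rfl
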